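/- (Tail bound for the normalizing sum.) There exist constants C₆ > 0 and α̃ > 1, depending only on f and q₀, such that for every α > α̃ and every n ≥ 1, P( π̃_{n,α}(1) ≤ 1/2 ) ≤ exp( −2 n · m_α^{−1} · C₆ ), where π̃_{n,α}(1) := (1/(n Z_α)) Σ_{i=1}^n w^i. -/

import Mathlib

open MeasureTheory ProbabilityTheory Real

noncomputable section

/-- `ℝ^d` as a Euclidean space. -/
abbrev E (d : ℕ) := EuclideanSpace ℝ (Fin d)

/-- The `i`-th standard basis vector of `ℝ^d`. -/
def bvec (d : ℕ) (i : Fin d) : E d := EuclideanSpace.single i 1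

/-- The normalizing constant `Z_α := ∫ exp (-α f)`. -/
def Zc {d : ℕ} (f : E d → ℝ) (α : ℝ) : ℝ := ∫ x, Real.exp (-α * f x)

/-- The Hessian matrix of `f` at `x`, via the second iterated derivative. -/
def hess {d : ℕ} (f : E d → ℝ) (x : E d) : Matrix (Fin d) (Fin d) ℝ :=
  Matrix.of fun i j => iteratedFDeriv ℝ 2 f x ![bvec d i, bvec d j]

/-- `m_α := √(det H_f(x⋆)) · (α/(2π))^{d/2}`. -/
def mconst {d : ℕ} (f : E d → ℝ) (xs : E d) (α : ℝ) : ℝ :=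
  Real.sqrt (hess f xs).det * (α / (2 * π)) ^ ((d : ℝ) / 2)

/-- The partial trace of `D³ f` at `x`: `PTr(D³f(x))_i = ∑_k ∂_i∂_k∂_k f(x)`. -/
def ptr3 {d : ℕ} (f : E d → ℝ) (x : E d) (i : Fin d) : ℝ :=
  ∑ k, iteratedFDeriv ℝ 3 f x ![bvec d i, bvec d k, bvec d k]

/-- The Laplace constant `C_{f,φ}` for a vector-valued test function `φ : ℝ^d → ℝ^q`. -/
def CL {d q : ℕ} (f : E d → ℝ) (x : E d) (φ : E d → E q) : ℝ :=
  ∑ i : Fin q,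
    |(∑ j : Fin d, iteratedFDeriv ℝ 2 (fun y => φ y i) x ![bvec d j, bvec d j]) -
      ∑ j : Fin d, fderiv ℝ (fun y => φ y i) x (bvec d j) * ptr3 f x j|

/-- The Laplace constant `C_{f,ψ}` for a scalar test function `ψ : ℝ^d → ℝ`. -/
def CLs {d : ℕ} (f : E d → ℝ) (x : E d) (ψ : E d → ℝ) : ℝ :=
  |(∑ j : Fin d, iteratedFDeriv ℝ 2 ψ x ![bvec d j, bvec d j]) -
    ∑ j : Fin d, fderiv ℝ ψ x (bvec d j) * ptr3 f x j|

/-- `π_α(φ) := ∫ φ dπ_α`, the mean of `φ` under the Gibbs measure `π_α ∝ exp(-α f)`. -/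
def piInt {d q : ℕ} (f : E d → ℝ) (α : ℝ) (φ : E d → E q) : E q :=
  ∫ x, (Real.exp (-α * f x) / Zc f α) • φ x

/-- Chernoff lower-tail bound for independent random variables with values in `[0, b]` and a
common mean `z`. -/
lemma measure_sum_le_half_le {Ω : Type*} [MeasurableSpace Ω] {μ : Measure Ω}
    [IsProbabilityMeasure μ] {n : ℕ} {Y : Fin n → Ω → ℝ} {b z : ℝ} (hb : 0 < b)
    (hY : ∀ i, Measurable (Y i)) (hY0 : ∀ i ω, 0 ≤ Y i ω) (hYb : ∀ i ω, Y i ω ≤ b)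
    (hmean : ∀ i, ∫ ω, Y i ω ∂μ = z) (hindep : iIndepFun Y μ) :
    μ.real {ω | ∑ i, Y i ω ≤ n * z / 2} ≤ Real.exp (-(n * (z / (16 * b)))) := by
  set t : ℝ := 1 / (4 * b) with ht
  have ht0 : 0 < t := by positivity
  have hYint : ∀ i, Integrable (Y i) μ := fun i =>
    Integrable.of_bound (hY i).aestronglyMeasurable b
      (ae_of_all _ fun ω => by rw [Real.norm_of_nonneg (hY0 i ω)]; exact hYb i ω)
  have hpoint : ∀ i ω, Real.exp (-t * Y i ω) ≤ 1 - 3 / 4 * t * Y i ω := by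
    intro i ω
    have h0 : 0 ≤ t * Y i ω := mul_nonneg ht0.le (hY0 i ω)
    have h1 : t * Y i ω ≤ 1 / 4 := by
      calc t * Y i ω ≤ t * b := mul_le_mul_of_nonneg_left (hYb i ω) ht0.le
        _ = 1 / 4 := by rw [ht]; field_simp
    have h2 := Real.abs_exp_sub_one_sub_id_le (x := -(t * Y i ω))
      (by rw [abs_neg, abs_of_nonneg h0]; linarith)
    have h3 := (abs_le.1 h2).2
    rw [neg_mul]
    nlinarith
  have hexpint : ∀ i, Integrable (fun ω => Real.exp (-t * Y i ω)) μ := fun i =>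
    Integrable.of_bound (((hY i).const_mul (-t)).exp).aestronglyMeasurable 1
      (ae_of_all _ fun ω => by
        rw [Real.norm_of_nonneg (Real.exp_pos _).le, Real.exp_le_one_iff]
        nlinarith [mul_nonneg ht0.le (hY0 i ω)])
  have hmgf : ∀ i, mgf (Y i) μ (-t) ≤ Real.exp (-(3 / 4 * t * z)) := by
    intro i
    calc mgf (Y i) μ (-t) ≤ ∫ ω, (1 - 3 / 4 * t * Y i ω) ∂μ :=
          integral_mono (hexpint i) ((integrable_const _).sub ((hYint i).const_mul _)) (hpoint i)
      _ = 1 - 3 / 4 * t * z := by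
          rw [integral_sub (integrable_const _) ((hYint i).const_mul _), integral_const_mul,
            hmean i]
          simp
      _ ≤ Real.exp (-(3 / 4 * t * z)) := by
          linarith [Real.add_one_le_exp (-(3 / 4 * t * z))]
  have hsumint : Integrable (fun ω => Real.exp (-t * (∑ i, Y i) ω)) μ :=
    hindep.integrable_exp_mul_sum hY (s := Finset.univ) fun i _ => hexpint i
  have hchern := measure_le_le_exp_mul_mgf (n * z / 2) (by linarith : -t ≤ 0) hsumint
  rw [hindep.mgf_sum hY] at hchern
  have hset : {ω | ∑ i, Y i ω ≤ n * z / 2} = {ω | (∑ i, Y i) ω ≤ n * z / 2} := by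
    ext ω; simp
  rw [hset]
  refine hchern.trans ?_
  calc Real.exp (- -t * (n * z / 2)) * ∏ i, mgf (Y i) μ (-t)
      ≤ Real.exp (- -t * (n * z / 2)) * ∏ _i : Fin n, Real.exp (-(3 / 4 * t * z)) := by
        gcongr with i
        · exact fun i _ => mgf_nonneg
        · exact hmgf i
    _ = Real.exp (-(n * (z / (16 * b)))) := by
        rw [Finset.prod_const, Finset.card_univ, Fintype.card_fin, ← Real.exp_nat_mul,
          ← Real.exp_add, ht]
        congr 1
        field_simp
        ring

/-- A `C²` function grows at most quadratically near a minimizer. -/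
lemma exists_sub_le_mul_sq {V : Type*} [NormedAddCommGroup V] [NormedSpace ℝ V]
    {f : V → ℝ} {a : V} (hf : ContDiff ℝ 2 f) (hmin : IsLocalMin f a) :
    ∃ K > 0, ∃ r > 0, ∀ x, ‖x - a‖ < r → f x - f a ≤ K * ‖x - a‖ ^ 2 := by
  have hdf : ContDiff ℝ 1 (fderiv ℝ f) := hf.fderiv_right (by norm_num)
  obtain ⟨K, s, hs, hK⟩ := hdf.contDiffAt.exists_lipschitzOnWith (x := a)
  obtain ⟨r, hr, hrs⟩ := Metric.mem_nhds_iff.1 hs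
  refine ⟨K + 1, by positivity, r, hr, fun x hx => ?_⟩
  have hbound : ∀ y ∈ Metric.closedBall a ‖x - a‖, ‖fderiv ℝ f y‖ ≤ K * ‖x - a‖ := by
    intro y hy
    rw [mem_closedBall_iff_norm] at hy
    have h := hK.norm_sub_le (hrs (mem_ball_iff_norm.2 (hy.trans_lt hx)))
      (hrs (Metric.mem_ball_self hr))
    rw [hmin.fderiv_eq_zero, sub_zero] at h
    exact h.trans (by gcongr)
  have h := (convex_closedBall a ‖x - a‖).norm_image_sub_le_of_norm_fderiv_le
    (fun y _ => (hf.differentiable (by norm_num)).differentiableAt) hbound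
    (Metric.mem_closedBall_self (norm_nonneg _)) (mem_closedBall_iff_norm.2 le_rfl)
  have h' := (le_abs_self _).trans h
  nlinarith [sq_nonneg ‖x - a‖]

/-- Powers above the first of an integrable Gibbs weight bounded below are integrable. -/
lemma integrable_exp_neg_mul {d : ℕ} {f : E d → ℝ} {xs : E d} (hf : Continuous f)
    (hmin : ∀ x, f xs ≤ f x) (hfint : Integrable fun x => Real.exp (-f x)) {α : ℝ}
    (hα : 1 ≤ α) : Integrable fun x => Real.exp (-α * f x) := by
  refine (hfint.const_mul (Real.exp (-(α - 1) * f xs))).mono'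
    (by fun_prop) (ae_of_all _ fun x => ?_)
  rw [Real.norm_of_nonneg (Real.exp_pos _).le, ← Real.exp_add]
  exact Real.exp_le_exp.2 (by nlinarith [hmin x])

/-- Laplace-type lower bound on the normalizing constant. -/
lemma exists_le_Zc {d : ℕ} {f : E d → ℝ} {xs : E d} (hf : ContDiff ℝ 2 f)
    (hmin : ∀ x, f xs ≤ f x) (hfint : Integrable fun x => Real.exp (-f x)) :
    ∃ κ > 0, ∃ αt > (1 : ℝ), ∀ α > αt,
      κ * (√α ^ d)⁻¹ * Real.exp (-α * f xs) ≤ Zc f α := by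
  obtain ⟨K, hK, r, hr, hquad⟩ := exists_sub_le_mul_sq hf
    (Filter.Eventually.of_forall hmin : IsLocalMin f xs)
  set v : ℝ := volume.real (Metric.ball (0 : E d) 1) with hv
  have hv0 : 0 < v :=
    ENNReal.toReal_pos (Metric.measure_ball_pos _ _ one_pos).ne' measure_ball_lt_top.ne
  refine ⟨Real.exp (-K) * v, by positivity, 1 + 1 / r ^ 2, by
    have : 0 < 1 / r ^ 2 := by positivity
    linarith, fun α hα => ?_⟩
  have hr2 : 0 < 1 / r ^ 2 := by positivity
  have hα1 : 1 ≤ α := by linarith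
  have hα0 : 0 < α := by linarith
  have hs0 : 0 < √α := Real.sqrt_pos.2 hα0
  have hsr : (√α)⁻¹ < r := by
    rw [inv_lt_comm₀ hs0 hr]
    refine Real.lt_sqrt_of_sq_lt ?_
    rw [inv_pow, ← one_div]
    linarith
  have hint := integrable_exp_neg_mul hf.continuous hmin hfint hα1
  have hvol : volume.real (Metric.closedBall xs (√α)⁻¹) = (√α ^ d)⁻¹ * v := by
    rw [Measure.real, Measure.addHaar_closedBall _ _ (by positivity), ENNReal.toReal_mul,
      ENNReal.toReal_ofReal (by positivity)]
    simp [hv, Measure.real]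
  have hpoint : ∀ x ∈ Metric.closedBall xs (√α)⁻¹,
      Real.exp (-K) * Real.exp (-α * f xs) ≤ Real.exp (-α * f x) := by
    intro x hx
    rw [mem_closedBall_iff_norm] at hx
    have hq := hquad x (hx.trans_lt hsr)
    have hsq : ‖x - xs‖ ^ 2 ≤ α⁻¹ := by
      calc ‖x - xs‖ ^ 2 ≤ (√α)⁻¹ ^ 2 := by gcongr
        _ = α⁻¹ := by rw [inv_pow, Real.sq_sqrt hα0.le]
    have hle : α * (f x - f xs) ≤ K := by
      calc α * (f x - f xs) ≤ α * (K * α⁻¹) := by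
            gcongr
            exact hq.trans (by gcongr)
        _ = K := by field_simp
    rw [← Real.exp_add]
    exact Real.exp_le_exp.2 (by nlinarith)
  calc Real.exp (-K) * v * (√α ^ d)⁻¹ * Real.exp (-α * f xs)
      = ∫ _x in Metric.closedBall xs (√α)⁻¹, Real.exp (-K) * Real.exp (-α * f xs) := by
        rw [setIntegral_const, hvol, smul_eq_mul]; ring
    _ ≤ ∫ x in Metric.closedBall xs (√α)⁻¹, Real.exp (-α * f x) :=
        setIntegral_mono_on (integrableOn_const measure_closedBall_lt_top.ne)
          hint.integrableOn Metric.isClosed_closedBall.measurableSet hpoint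
    _ ≤ Zc f α := setIntegral_le_integral hint (ae_of_all _ fun x => (Real.exp_pos _).le)

/-- tail bound for the normalizing sum. -/
theorem stmt11 {d : ℕ} (hd : 1 ≤ d)
    {Ω : Type*} [MeasureSpace Ω] [IsProbabilityMeasure (ℙ : Measure Ω)]
    (f : E d → ℝ) (xs : E d)
    (hf : ContDiff ℝ 4 f)
    (hmin : ∀ x, x ≠ xs → f xs < f x)
    (hpd : (hess f xs).PosDef)
    (hfint : Integrable fun x => Real.exp (-f x))
    (q₀ : E d → ℝ) (hq₀smooth : ContDiff ℝ 2 q₀) (hq₀pos : ∀ x, 0 < q₀ x)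
    (hq₀int : Integrable q₀) (hq₀prob : ∫ x, q₀ x = 1)
    (c₀ : ℝ) (hc₀ : 0 < c₀) (hdom : ∀ x, Real.exp (-(f x - f xs)) ≤ c₀ * q₀ x)
    (hr3 : ContDiff ℝ 2 fun x => 1 / q₀ x)
    (hCc : 0 < CLs f xs fun x => 1 / q₀ x) :
    ∃ C₆ > 0, ∃ αt > (1 : ℝ), ∀ α > αt, ∀ n : ℕ, 1 ≤ n →
      ∀ X : Fin n → Ω → E d,
        (∀ i, Measurable (X i)) →
        (∀ i, Measure.map (X i) ℙ = volume.withDensity fun x => ENNReal.ofReal (q₀ x)) →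
        iIndepFun X ℙ →
        ℙ {ω | (1 / ((n : ℝ) * Zc f α)) *
              ∑ i, Real.exp (-α * f (X i ω)) / q₀ (X i ω) ≤ 1 / 2} ≤
          ENNReal.ofReal (Real.exp (-2 * (n : ℝ) * (mconst f xs α)⁻¹ * C₆)) := by
  have hmin' : ∀ x, f xs ≤ f x := fun x => by
    rcases eq_or_ne x xs with rfl | h
    exacts [le_rfl, (hmin x h).le]
  obtain ⟨κ, hκ, αt, hαt, hZ⟩ := exists_le_Zc (hf.of_le (by norm_num)) hmin' hfint
  have hdet : 0 < √(hess f xs).det := Real.sqrt_pos.2 hpd.det_pos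
  refine ⟨κ * √(hess f xs).det / (32 * c₀ * √(2 * π) ^ d), by positivity, αt, hαt, ?_⟩
  intro α hα n hn X hX hlaw hindep
  have hα1 : 1 < α := hαt.trans hα
  have hα0 : 0 < α := by linarith
  have hZα := hZ α hα
  have hs0 : 0 < √α := Real.sqrt_pos.2 hα0
  have hZ0 : 0 < Zc f α := lt_of_lt_of_le (by positivity) hZα
  set b : ℝ := c₀ * Real.exp (-α * f xs) with hb
  have hb0 : 0 < b := by positivity
  set w : E d → ℝ := fun x => Real.exp (-α * f x) / q₀ x with hw
  have hwm : Measurable w :=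
    ((hf.continuous.measurable.const_mul (-α)).exp).div hq₀smooth.continuous.measurable
  have hw0 : ∀ x, 0 ≤ w x := fun x => div_nonneg (Real.exp_pos _).le (hq₀pos x).le
  have hwb : ∀ x, w x ≤ b := by
    intro x
    rw [hw, div_le_iff₀ (hq₀pos x)]
    calc Real.exp (-α * f x) ≤ Real.exp (-α * f xs) * Real.exp (-(f x - f xs)) := by
          rw [← Real.exp_add]
          exact Real.exp_le_exp.2 (by nlinarith [hmin' x])
      _ ≤ Real.exp (-α * f xs) * (c₀ * q₀ x) := by gcongr; exact hdom x
      _ = b * q₀ x := by rw [hb]; ring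
  have hmean : ∀ i, ∫ ω, w (X i ω) = Zc f α := by
    intro i
    rw [← integral_map (hX i).aemeasurable hwm.aestronglyMeasurable, hlaw i,
      integral_withDensity_eq_integral_toReal_smul
        hq₀smooth.continuous.measurable.ennreal_ofReal (ae_of_all _ fun x => ENNReal.ofReal_lt_top)]
    refine integral_congr_ae (ae_of_all _ fun x => ?_)
    simp only [hw, ENNReal.toReal_ofReal (hq₀pos x).le, smul_eq_mul]
    exact mul_div_cancel₀ _ (hq₀pos x).ne'
  have htail := measure_sum_le_half_le hb0 (fun i => hwm.comp (hX i)) (fun i ω => hw0 (X i ω))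
    (fun i ω => hwb (X i ω)) hmean (hindep.comp (fun _ => w) fun _ => hwm)
  have hn0 : (0 : ℝ) < n := by exact_mod_cast hn
  have hset : {ω | (1 / ((n : ℝ) * Zc f α)) *
      ∑ i, Real.exp (-α * f (X i ω)) / q₀ (X i ω) ≤ 1 / 2} =
      {ω | ∑ i, (w ∘ X i) ω ≤ n * Zc f α / 2} := by
    ext ω
    simp only [Set.mem_ofPred_eq, Function.comp, hw]
    rw [one_div_mul_eq_div, div_le_iff₀ (by positivity)]
    ring_nf
  have hm : (mconst f xs α)⁻¹ =
      √(2 * π) ^ d * (√α ^ d)⁻¹ / √(hess f xs).det := by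
    rw [mconst, Real.rpow_div_two_eq_sqrt _ (by positivity), Real.rpow_natCast,
      Real.sqrt_div hα0.le, div_pow]
    field_simp
  rw [hset, ← ofReal_measureReal]
  refine ENNReal.ofReal_le_ofReal (htail.trans (Real.exp_le_exp.2 ?_))
  have hkey : κ * (√α ^ d)⁻¹ / (16 * c₀) ≤ Zc f α / (16 * b) := by
    rw [div_le_div_iff₀ (by positivity) (by positivity), hb]
    nlinarith [mul_le_mul_of_nonneg_left hZα hc₀.le]
  calc -(n * (Zc f α / (16 * b))) ≤ -(n * (κ * (√α ^ d)⁻¹ / (16 * c₀))) := by gcongr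
    _ = _ := by
      rw [hm]
      have : 0 < √(2 * π) := by positivity
      field_simp
      norm_num
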